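/- arXiv:math/0503467 — 10 statements merged into one kernel-verified Lean document; each statement's English description precedes it below -/
import Mathlib

section
/- For every λ ∈ ℓ̂ there exists μ ∈ ℓ̂ with λ − μ ∈ ℓ̃ such that |⟨η, μ⟩| ≤ 1 for every root η ∈ Δ, i.e. |μ_i − μ_j| ≤ 1 for all i ≠ j and |μ_i + μ_j + μ_k + μ_l| ≤ 1 for all distinct i, j, k, l. (In particular both classes of the quotient ℓ̂/ℓ̃ ≅ ℤ/2 have representatives pairing with every root with absolute value at most 1; one may take μ = 0 and μ = ε_1 + ε_2.) -/
/-- The vector `ε₁ + ε₂`, the highest weight of the 56-dimensional representation. -/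
noncomputable def minusculeE7 (i : Fin 8) : ℝ := if i.val < 2 then 3 / 4 else -1 / 4

theorem sum_minusculeE7 : ∑ i, minusculeE7 i = 0 := by
  simp [minusculeE7, Fin.sum_univ_eight]
  norm_num

theorem exists_minusculeE7_add_quarter (i : Fin 8) : ∃ m : ℤ, minusculeE7 i = m - 1 / 4 := by
  unfold minusculeE7
  split_ifs
  · exact ⟨1, by norm_num⟩
  · exact ⟨0, by norm_num⟩

theorem abs_minusculeE7_sub_le_one (i j : Fin 8) : |minusculeE7 i - minusculeE7 j| ≤ 1 := by
  unfold minusculeE7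
  split_ifs <;> norm_num

theorem abs_minusculeE7_add_le_one {i j k l : Fin 8} (hij : i ≠ j) (hik : i ≠ k) (hil : i ≠ l)
    (hjk : j ≠ k) (hjl : j ≠ l) (hkl : k ≠ l) :
    |minusculeE7 i + minusculeE7 j + minusculeE7 k + minusculeE7 l| ≤ 1 := by
  unfold minusculeE7
  split_ifs <;> first | omega | norm_num

/-- **Type `E₇` representatives.**  In `𝔱 = {ξ ∈ ℝ⁸ : Σ ξᵢ = 0}` with lattices
`ℓ̂ = {λ ∈ 𝔱 : 4λᵢ ∈ ℤ and λᵢ - λⱼ ∈ ℤ}` and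
`ℓ̃ = {λ ∈ 𝔱 : λᵢ + λⱼ ∈ ℤ and λᵢ - λⱼ ∈ ℤ}`, every `λ ∈ ℓ̂` differs by an element of
`ℓ̃` from some `μ ∈ ℓ̂` pairing with every root of `E₇` with absolute value at most `1`,
i.e. `|μᵢ - μⱼ| ≤ 1` for `i ≠ j` and `|μᵢ + μⱼ + μₖ + μₗ| ≤ 1` for `i, j, k, l`
distinct. -/
theorem typeE7_small_representative
    (lam : Fin 8 → ℝ)
    (hsum : ∑ i, lam i = 0)
    (h4 : ∀ i, ∃ m : ℤ, 4 * lam i = m)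
    (hdiff : ∀ i j, ∃ m : ℤ, lam i - lam j = m) :
    ∃ mu : Fin 8 → ℝ,
      (∑ i, mu i = 0) ∧
      (∀ i, ∃ m : ℤ, 4 * mu i = m) ∧
      (∀ i j, ∃ m : ℤ, mu i - mu j = m) ∧
      (∑ i, (lam i - mu i) = 0) ∧
      (∀ i j, ∃ m : ℤ, (lam i - mu i) + (lam j - mu j) = m) ∧
      (∀ i j, ∃ m : ℤ, (lam i - mu i) - (lam j - mu j) = m) ∧
      (∀ i j, i ≠ j → |mu i - mu j| ≤ 1) ∧
      (∀ i j k l : Fin 8, i ≠ j → i ≠ k → i ≠ l → j ≠ k → j ≠ l → k ≠ l →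
        |mu i + mu j + mu k + mu l| ≤ 1) := by
  obtain ⟨m, hm⟩ := h4 0
  have hlam (i : Fin 8) : ∃ n : ℤ, lam i = n + m / 4 := by
    obtain ⟨n, hn⟩ := hdiff i 0
    exact ⟨n, by linarith⟩
  rcases Int.even_or_odd' m with ⟨c, rfl | rfl⟩
  · refine ⟨0, by simp, fun _ => ⟨0, by simp⟩, fun _ _ => ⟨0, by simp⟩, by simpa using hsum,
      fun i j => ?_, by simpa using hdiff, by simp, by simp⟩
    obtain ⟨a, ha⟩ := hlam i
    obtain ⟨b, hb⟩ := hlam j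
    refine ⟨a + b + c, ?_⟩
    rw [ha, hb]
    push_cast
    simp only [Pi.zero_apply]
    ring
  · refine ⟨minusculeE7, sum_minusculeE7, fun i => ?_, fun i j => ?_, ?_, fun i j => ?_,
      fun i j => ?_, fun i j _ => abs_minusculeE7_sub_le_one i j,
      fun i j k l => abs_minusculeE7_add_le_one⟩
    · obtain ⟨a, ha⟩ := exists_minusculeE7_add_quarter i
      exact ⟨4 * a - 1, by rw [ha]; push_cast; ring⟩
    · obtain ⟨a, ha⟩ := exists_minusculeE7_add_quarter i
      obtain ⟨b, hb⟩ := exists_minusculeE7_add_quarter j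
      exact ⟨a - b, by rw [ha, hb]; push_cast; ring⟩
    · rw [Finset.sum_sub_distrib, hsum, sum_minusculeE7, sub_zero]
    · obtain ⟨a, ha⟩ := exists_minusculeE7_add_quarter i
      obtain ⟨b, hb⟩ := exists_minusculeE7_add_quarter j
      obtain ⟨p, hp⟩ := hlam i
      obtain ⟨q, hq⟩ := hlam j
      exact ⟨p + q - a - b + c + 1, by rw [ha, hb, hp, hq]; push_cast; ring⟩
    · obtain ⟨a, ha⟩ := exists_minusculeE7_add_quarter i
      obtain ⟨b, hb⟩ := exists_minusculeE7_add_quarter j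
      obtain ⟨p, hp⟩ := hdiff i j
      exact ⟨p - a + b, by push_cast; linarith⟩
end

section
/- Let λ ∈ ℤ^{n+1} satisfy λ_1 + … + λ_{n+1} = 0, λ_1 ≥ λ_2 ≥ … ≥ λ_{n+1}, and λ_1 − λ_{n+1} ≤ 2. Then there exist finitely many pairwise orthogonal roots η_1, …, η_k ∈ Δ and positive rational numbers a_1, …, a_k such that λ = a_1 η_1 + … + a_k η_k and ⟨λ, η_m⟩ = a_m ⟨η_m, η_m⟩ = 2 for every m. (Concretely, there are pairwise disjoint index pairs (i_m, j_m) with λ = Σ_m (e_{i_m} − e_{j_m}) and λ_{i_m} − λ_{j_m} = 2.) -/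
/-- The `i`-th standard basis vector of `ℝ^{n+1}`. -/
def stdA (n : ℕ) (i : Fin (n + 1)) : Fin (n + 1) → ℝ := fun t => if t = i then 1 else 0

/-- The roots of type `Aₙ`: `eᵢ - eⱼ` for `i ≠ j`. -/
def rootsA (n : ℕ) : Set (Fin (n + 1) → ℝ) :=
  {v | ∃ i j, i ≠ j ∧ v = stdA n i - stdA n j}

theorem sum_mul_stdA_sub_stdA (n : ℕ) (v : Fin (n + 1) → ℝ) (i j : Fin (n + 1)) :
    ∑ t, v t * (stdA n i - stdA n j) t = v i - v j := by
  simp [stdA, mul_sub, Finset.sum_sub_distrib]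

/-- Summing the basis vectors indexed by a finite set gives its indicator function. -/
theorem sum_stdA_orderEmbOfFin (n : ℕ) (S : Finset (Fin (n + 1))) {k : ℕ} (h : S.card = k)
    (t : Fin (n + 1)) :
    ∑ m, stdA n (S.orderEmbOfFin h m) t = if t ∈ S then 1 else 0 := by
  have key : ∑ m, stdA n (S.orderEmbOfFin h m) t = ∑ i ∈ S, stdA n i t := by
    conv_rhs => rw [← Finset.map_orderEmbOfFin_univ S h]
    rw [Finset.sum_map]
    rfl
  rw [key]
  simp [stdA]

/-- Integers summing to zero that are pairwise at most two apart are at most one. -/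
theorem le_one_of_sum_eq_zero_of_sub_le_two {ι : Type*} [Fintype ι] (z : ι → ℤ)
    (hsum : ∑ i, z i = 0) (hdiff : ∀ i j, z i - z j ≤ 2) (i : ι) : z i ≤ 1 := by
  by_contra! hi
  have hnonneg : ∀ j ∈ Finset.univ, 0 ≤ z j := fun j _ => by
    have := hdiff i j
    omega
  have := (Finset.sum_eq_zero_iff_of_nonneg hnonneg).1 hsum i (Finset.mem_univ i)
  omega

/-- **Claim (a) for type `Aₙ`.**  If `λ ∈ ℤ^{n+1}` satisfies `Σ λᵢ = 0`,
`λ₁ ≥ ⋯ ≥ λ_{n+1}` and `λ₁ - λ_{n+1} ≤ 2`, then `λ` is a positive rational combination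
`λ = Σ aₘ ηₘ` of pairwise orthogonal roots `ηₘ` with
`⟨λ, ηₘ⟩ = aₘ ⟨ηₘ, ηₘ⟩ = 2` for every `m`. -/
theorem typeA_orthogonal_decomposition (n : ℕ) (hn : 1 ≤ n)
    (lam : Fin (n + 1) → ℝ)
    (hint : ∀ i, ∃ m : ℤ, lam i = m)
    (hsum : ∑ i, lam i = 0)
    (hmono : ∀ i j : Fin (n + 1), i ≤ j → lam j ≤ lam i)
    (hhighest : lam 0 - lam (Fin.last n) ≤ 2) :
    ∃ (k : ℕ) (η : Fin k → (Fin (n + 1) → ℝ)) (a : Fin k → ℚ),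
      (∀ m, η m ∈ rootsA n) ∧
      (∀ m m', m ≠ m' → ∑ t, η m t * η m' t = 0) ∧
      (∀ m, 0 < a m) ∧
      lam = ∑ m, (a m : ℝ) • η m ∧
      (∀ m, (∑ t, lam t * η m t = 2) ∧ (a m : ℝ) * ∑ t, η m t * η m t = 2) := by
  choose z hz using hint
  have hzsum : ∑ i, z i = 0 := by
    have : ((∑ i, z i : ℤ) : ℝ) = 0 := by
      push_cast
      simpa only [hz] using hsum
    exact_mod_cast this
  have hdiff : ∀ i j, z i - z j ≤ 2 := fun i j => by
    have h : lam i - lam j ≤ 2 := by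
      linarith [hmono 0 i (Fin.zero_le i), hmono j (Fin.last n) (Fin.le_last j)]
    rw [hz, hz] at h
    exact_mod_cast h
  have hle : ∀ i, z i ≤ 1 := le_one_of_sum_eq_zero_of_sub_le_two z hzsum hdiff
  have hge : ∀ i, -z i ≤ 1 :=
    le_one_of_sum_eq_zero_of_sub_le_two (fun i => -z i) (by simp [hzsum]) fun i j => by
      have := hdiff j i
      omega
  set P := Finset.univ.filter fun i => z i = 1 with hP
  set N := Finset.univ.filter fun i => z i = -1 with hN
  have hind : ∀ i, z i = (if i ∈ P then 1 else 0) - (if i ∈ N then 1 else 0) := fun i => by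
    have := hle i
    have := hge i
    simp only [hP, hN, Finset.mem_filter, Finset.mem_univ, true_and]
    split_ifs <;> omega
  have hcard : N.card = P.card := by
    have h := hzsum
    rw [Finset.sum_congr rfl fun i _ => hind i, Finset.sum_sub_distrib] at h
    simp only [Finset.sum_ite_mem, Finset.univ_inter, Finset.sum_const, nsmul_eq_mul,
      mul_one] at h
    omega
  set p := P.orderEmbOfFin rfl
  set q := N.orderEmbOfFin hcard
  have hp : ∀ m, z (p m) = 1 := fun m =>
    (Finset.mem_filter.1 (P.orderEmbOfFin_mem rfl m)).2
  have hq : ∀ m, z (q m) = -1 := fun m =>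
    (Finset.mem_filter.1 (N.orderEmbOfFin_mem hcard m)).2
  have hpq : ∀ m m', p m ≠ q m' := fun m m' h => by
    have h1 := hp m
    rw [h, hq] at h1
    omega
  refine ⟨P.card, fun m => stdA n (p m) - stdA n (q m), fun _ => 1,
    fun m => ⟨p m, q m, hpq m m, rfl⟩, fun m m' hm => ?_, fun _ => one_pos, ?_, fun m => ⟨?_, ?_⟩⟩
  · rw [sum_mul_stdA_sub_stdA]
    simp [stdA, hpq, (hpq _ _).symm, hm.symm]
  · ext t
    simp only [Rat.cast_one, one_smul, Finset.sum_apply, Pi.sub_apply, Finset.sum_sub_distrib]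
    rw [sum_stdA_orderEmbOfFin, sum_stdA_orderEmbOfFin, hz, hind]
    push_cast
    rfl
  · rw [sum_mul_stdA_sub_stdA, hz, hz, hp, hq]
    norm_num
  · rw [sum_mul_stdA_sub_stdA]
    simp [stdA, hpq, (hpq _ _).symm]
    norm_num
end

section
/- Let λ ∈ ℤ^n satisfy λ_1 + … + λ_n ∈ 2ℤ, λ_1 ≥ λ_2 ≥ … ≥ λ_n ≥ 0, and λ_1 + λ_2 ≤ 2. Then there exist finitely many pairwise orthogonal roots η_1, …, η_k ∈ Δ and positive rational numbers a_1, …, a_k such that λ = a_1 η_1 + … + a_k η_k and ⟨λ, η_m⟩ = a_m ⟨η_m, η_m⟩ = 2 for every m. -/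
/-- The `i`-th standard basis vector of `ℝⁿ`. -/
def stdB (n : ℕ) (i : Fin n) : Fin n → ℝ := fun t => if t = i then 1 else 0

/-- The roots of type `Bₙ`: `±eᵢ` and `±eᵢ ± eⱼ` for `i ≠ j`. -/
def rootsB (n : ℕ) : Set (Fin n → ℝ) :=
  {v | (∃ i, v = stdB n i ∨ v = -stdB n i) ∨
       (∃ i j, i ≠ j ∧ (v = stdB n i + stdB n j ∨ v = stdB n i - stdB n j ∨
                        v = -stdB n i + stdB n j ∨ v = -stdB n i - stdB n j))}

theorem sum_mul_stdB (n : ℕ) (v : Fin n → ℝ) (i : Fin n) : ∑ t, v t * stdB n i t = v i := by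
  simp [stdB]

/-- The indicator of a finset of even size is a sum of pairwise orthogonal roots `eᵢ + eⱼ`. -/
theorem exists_orthogonal_roots_of_indicator (n k : ℕ) (S : Finset (Fin n))
    (hS : S.card = k * 2) (lam : Fin n → ℝ) (hlam : ∀ i, lam i = if i ∈ S then 1 else 0) :
    ∃ η : Fin k → (Fin n → ℝ),
      (∀ m, η m ∈ rootsB n) ∧
      (∀ m m', m ≠ m' → ∑ t, η m t * η m' t = 0) ∧
      lam = ∑ m, η m ∧
      (∀ m, (∑ t, lam t * η m t = 2) ∧ ∑ t, η m t * η m t = 2) := by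
  let f : Fin k × Fin 2 ≃ S := finProdFinEquiv.trans (S.equivFinOfCardEq hS).symm
  have hf : ∀ p q, (f p : Fin n) = f q ↔ p = q := fun p q => by
    rw [Subtype.coe_inj, f.injective.eq_iff]
  refine ⟨fun m => stdB n (f (m, 0)) + stdB n (f (m, 1)), fun m => ?_, fun m m' h => ?_, ?_,
    fun m => ⟨?_, ?_⟩⟩
  · exact Or.inr ⟨f (m, 0), f (m, 1), by simp [hf], Or.inl rfl⟩
  · simp only [Pi.add_apply, mul_add, Finset.sum_add_distrib, sum_mul_stdB]
    simp [stdB, hf, Ne.symm h]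
  · have h1 : lam = ∑ x : S, stdB n x := by
      rw [Finset.sum_coe_sort S (fun x => stdB n x)]
      ext t
      simp [hlam, stdB, Finset.sum_apply]
    rw [h1, ← f.sum_comp, Fintype.sum_prod_type]
    simp [Fin.sum_univ_two]
  · simp only [Pi.add_apply, mul_add, Finset.sum_add_distrib, sum_mul_stdB, hlam]
    simp only [Finset.coe_mem, if_true]
    norm_num
  · simp only [Pi.add_apply, mul_add, Finset.sum_add_distrib, sum_mul_stdB]
    simp [stdB, hf]
    norm_num

/-- **Claim (a) for type `Bₙ`.**  If `λ ∈ ℤⁿ` satisfies `Σ λᵢ ∈ 2ℤ`,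
`λ₁ ≥ ⋯ ≥ λₙ ≥ 0` and `λ₁ + λ₂ ≤ 2`, then `λ` is a positive rational combination
`λ = Σ aₘ ηₘ` of pairwise orthogonal roots `ηₘ` with
`⟨λ, ηₘ⟩ = aₘ ⟨ηₘ, ηₘ⟩ = 2` for every `m`. -/
theorem typeB_orthogonal_decomposition (n : ℕ) (hn : 2 ≤ n)
    (lam : Fin n → ℝ)
    (hint : ∀ i, ∃ m : ℤ, lam i = m)
    (heven : ∃ k : ℤ, ∑ i, lam i = 2 * k)
    (hmono : ∀ i j : Fin n, i ≤ j → lam j ≤ lam i)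
    (hnonneg : ∀ i, 0 ≤ lam i)
    (hhighest : lam ⟨0, by omega⟩ + lam ⟨1, by omega⟩ ≤ 2) :
    ∃ (k : ℕ) (η : Fin k → (Fin n → ℝ)) (a : Fin k → ℚ),
      (∀ m, η m ∈ rootsB n) ∧
      (∀ m m', m ≠ m' → ∑ t, η m t * η m' t = 0) ∧
      (∀ m, 0 < a m) ∧
      lam = ∑ m, (a m : ℝ) • η m ∧
      (∀ m, (∑ t, lam t * η m t = 2) ∧ (a m : ℝ) * ∑ t, η m t * η m t = 2) := by
  choose c hc using hint
  have hle0 : ∀ i, c i ≤ c ⟨0, by omega⟩ := fun i => by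
    have := hmono ⟨0, by omega⟩ i (Fin.mk_le_of_le_val (Nat.zero_le _))
    rw [hc, hc] at this
    exact_mod_cast this
  have hc0 : ∀ i, 0 ≤ c i := fun i => by
    have := hnonneg i
    rw [hc] at this
    exact_mod_cast this
  have hc2 : c ⟨0, by omega⟩ + c ⟨1, by omega⟩ ≤ 2 := by
    rw [hc, hc] at hhighest
    exact_mod_cast hhighest
  have hc1 := hc0 ⟨1, by omega⟩
  by_cases h2 : c ⟨0, by omega⟩ = 2
  · have hlam : lam = (2 : ℝ) • stdB n ⟨0, by omega⟩ := by
      ext t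
      by_cases ht : t = ⟨0, by omega⟩
      · subst ht
        simp [stdB, hc, h2]
      · have hle : c t ≤ c ⟨1, by omega⟩ := by
          have := hmono ⟨1, by omega⟩ t (by
            rw [Fin.le_def]
            have : (t : ℕ) ≠ 0 := fun h => ht (Fin.ext h)
            change 1 ≤ (t : ℕ)
            omega)
          rw [hc, hc] at this
          exact_mod_cast this
        have hz : c t = 0 := by
          have := hc0 t
          omega
        simp [stdB, hc, hz, ht]
    refine ⟨1, fun _ => stdB n ⟨0, by omega⟩, fun _ => 2, fun _ => Or.inl ⟨_, Or.inl rfl⟩,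
      fun m m' h => absurd (Subsingleton.elim m m') h, fun _ => by norm_num, by simpa using hlam,
      fun _ => ⟨?_, ?_⟩⟩
    · rw [sum_mul_stdB, hc, h2]
      norm_num
    · rw [sum_mul_stdB]
      simp [stdB]
  · let S : Finset (Fin n) := Finset.univ.filter fun i => c i = 1
    have hlam : ∀ i, lam i = if i ∈ S then 1 else 0 := fun i => by
      have h0 := hc0 i
      have h1 := hle0 i
      rw [hc]
      rcases (by omega : c i = 0 ∨ c i = 1) with h | h <;> simp [S, h]
    obtain ⟨k, hk⟩ := heven
    have hS : (S.card : ℤ) = 2 * k := by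
      have : (S.card : ℝ) = 2 * k := by
        rw [← hk]
        simp [hlam]
      exact_mod_cast this
    obtain ⟨η, h1, h2, h3, h4⟩ :=
      exists_orthogonal_roots_of_indicator n k.toNat S (by omega) lam hlam
    exact ⟨k.toNat, η, fun _ => 1, h1, h2, fun _ => one_pos, by simpa using h3,
      by simpa using h4⟩
end

section
/- Let λ ∈ ℓ̃ satisfy λ_2 ≥ λ_3 ≥ … ≥ λ_8, λ_1 + λ_6 + λ_7 + λ_8 ≥ 0, and λ_1 − λ_8 ≤ 2. Then there exist finitely many pairwise orthogonal roots η_1, …, η_k ∈ Δ such that λ = η_1 + … + η_k and ⟨λ, η_m⟩ = 2 for every m (each root η ∈ Δ satisfies ⟨η, η⟩ = 2, so this is the decomposition λ = Σ a_m η_m with ⟨λ, η_m⟩ = a_m ⟨η_m, η_m⟩ = 2). -/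
/-- The vector `εᵢ = eᵢ - (1/8)(e₁ + ⋯ + e₈)` in `ℝ⁸`. -/
noncomputable def epsE7 (i : Fin 8) : Fin 8 → ℝ := fun t => (if t = i then 1 else 0) - 1 / 8

/-- The roots of type `E₇`: `εᵢ - εⱼ` for `i ≠ j`, and `εᵢ + εⱼ + εₖ + εₗ` for
`i, j, k, l` distinct. -/
def rootsE7 : Set (Fin 8 → ℝ) :=
  {v | (∃ i j, i ≠ j ∧ v = epsE7 i - epsE7 j) ∨
       (∃ i j k l : Fin 8, i ≠ j ∧ i ≠ k ∧ i ≠ l ∧ j ≠ k ∧ j ≠ l ∧ k ≠ l ∧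
          v = epsE7 i + epsE7 j + epsE7 k + epsE7 l)}

/-- A dominant vector of the lattice of type `E₇` with `⟨λ, δ⟩ ≤ 2` is zero, the highest root, or
one of two further vectors. -/
theorem dominant_of_pairing_highest_le_two
    (lam : Fin 8 → ℝ)
    (hsum : ∑ i, lam i = 0)
    (hlat : ∀ i j, (∃ m : ℤ, lam i + lam j = m) ∧ (∃ m : ℤ, lam i - lam j = m))
    (hchamber : ∀ i j : Fin 8, 1 ≤ (i : ℕ) → i ≤ j → lam j ≤ lam i)
    (hchamber' : 0 ≤ lam 0 + lam 5 + lam 6 + lam 7)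
    (hhighest : lam 0 - lam 7 ≤ 2) :
    lam = 0 ∨ lam = ![1, 0, 0, 0, 0, 0, 0, -1] ∨
      lam = ![3 / 2, 1 / 2, 1 / 2, -1 / 2, -1 / 2, -1 / 2, -1 / 2, -1 / 2] ∨
      lam = ![3 / 2, 3 / 2, -1 / 2, -1 / 2, -1 / 2, -1 / 2, -1 / 2, -1 / 2] := by
  obtain ⟨p, hp⟩ := (hlat 0 1).1
  obtain ⟨u, hu⟩ := (hlat 0 5).1
  obtain ⟨v, hv⟩ := (hlat 6 7).1
  obtain ⟨a, ha⟩ := (hlat 1 2).2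
  obtain ⟨b, hb⟩ := (hlat 2 3).2
  obtain ⟨c, hc⟩ := (hlat 3 4).2
  obtain ⟨d, hd⟩ := (hlat 4 5).2
  obtain ⟨e, he⟩ := (hlat 5 6).2
  obtain ⟨f, hf⟩ := (hlat 6 7).2
  have h12 := hchamber 1 2 (by decide) (by decide)
  have h23 := hchamber 2 3 (by decide) (by decide)
  have h34 := hchamber 3 4 (by decide) (by decide)
  have h45 := hchamber 4 5 (by decide) (by decide)
  have h56 := hchamber 5 6 (by decide) (by decide)
  have h67 := hchamber 6 7 (by decide) (by decide)
  rw [Fin.sum_univ_eight] at hsum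
  have ha0 : 0 ≤ a := by exact_mod_cast (by linarith : (0 : ℝ) ≤ a)
  have hb0 : 0 ≤ b := by exact_mod_cast (by linarith : (0 : ℝ) ≤ b)
  have hc0 : 0 ≤ c := by exact_mod_cast (by linarith : (0 : ℝ) ≤ c)
  have hd0 : 0 ≤ d := by exact_mod_cast (by linarith : (0 : ℝ) ≤ d)
  have he0 : 0 ≤ e := by exact_mod_cast (by linarith : (0 : ℝ) ≤ e)
  have hf0 : 0 ≤ f := by exact_mod_cast (by linarith : (0 : ℝ) ≤ f)
  have hg0 : 0 ≤ u + v := by exact_mod_cast (by linarith : (0 : ℝ) ≤ u + v)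
  have hmarks : a + 2 * b + 3 * c + 4 * d + 3 * e + 2 * f + 2 * (u + v) ≤ 2 := by
    exact_mod_cast (by linarith :
      (a + 2 * b + 3 * c + 4 * d + 3 * e + 2 * f + 2 * (u + v) : ℝ) ≤ 2)
  have hparity : 2 * p = 3 * a + 4 * b + 5 * c + 6 * d + 4 * e + 2 * f + 3 * (u + v) := by
    exact_mod_cast (by linarith :
      (2 * p : ℝ) = 3 * a + 4 * b + 5 * c + 6 * d + 4 * e + 2 * f + 3 * (u + v))
  obtain rfl : c = 0 := by omega
  obtain rfl : d = 0 := by omega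
  obtain rfl : e = 0 := by omega
  obtain rfl : v = -u := by omega
  have hcases : (a = 0 ∧ b = 0 ∧ f = 0) ∨ (a = 0 ∧ b = 0 ∧ f = 1) ∨ (a = 0 ∧ b = 1 ∧ f = 0) ∨
      (a = 2 ∧ b = 0 ∧ f = 0) := by omega
  push_cast at *
  rcases hcases with ⟨rfl, rfl, rfl⟩ | ⟨rfl, rfl, rfl⟩ | ⟨rfl, rfl, rfl⟩ | ⟨rfl, rfl, rfl⟩
  · left
    ext i
    fin_cases i <;> simp <;> push_cast at * <;> linarith
  · right; left
    ext i
    fin_cases i <;> simp <;> push_cast at * <;> linarith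
  · right; right; left
    ext i
    fin_cases i <;> simp <;> push_cast at * <;> linarith
  · right; right; right
    ext i
    fin_cases i <;> simp <;> push_cast at * <;> linarith

theorem highestRoot_mem_rootsE7 : (![1, 0, 0, 0, 0, 0, 0, -1] : Fin 8 → ℝ) ∈ rootsE7 := by
  refine Or.inl ⟨0, 7, by decide, ?_⟩
  ext t
  fin_cases t <;> norm_num [epsE7, Fin.ext_iff]

/-- A vector with four coordinates `1 / 2` and the other four `-1 / 2` is a root. -/
theorem mem_rootsE7_of_eq_half {v : Fin 8 → ℝ} (i j k l : Fin 8)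
    (h : i ≠ j ∧ i ≠ k ∧ i ≠ l ∧ j ≠ k ∧ j ≠ l ∧ k ≠ l)
    (hv : ∀ t, v t = if t = i ∨ t = j ∨ t = k ∨ t = l then 1 / 2 else -1 / 2) :
    v ∈ rootsE7 := by
  obtain ⟨hij, hik, hil, hjk, hjl, hkl⟩ := h
  refine Or.inr ⟨i, j, k, l, hij, hik, hil, hjk, hjl, hkl, ?_⟩
  ext t
  simp only [hv, epsE7, Pi.add_apply]
  split_ifs <;> first | (exfalso; grind) | norm_num

/-- **Claim (a) for type `E₇`.**  If `λ` lies in the integral lattice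
`ℓ̃ = {λ ∈ 𝔱 : λᵢ + λⱼ ∈ ℤ, λᵢ - λⱼ ∈ ℤ}` and in the positive Weyl chamber
(`λ₂ ≥ ⋯ ≥ λ₈` and `λ₁ + λ₆ + λ₇ + λ₈ ≥ 0`), and `⟨λ, δ⟩ = λ₁ - λ₈ ≤ 2`, then `λ` is a
sum of pairwise orthogonal roots `ηₘ` with `⟨λ, ηₘ⟩ = 2` for every `m`. -/
theorem typeE7_orthogonal_decomposition
    (lam : Fin 8 → ℝ)
    (hsum : ∑ i, lam i = 0)
    (hlat : ∀ i j, (∃ m : ℤ, lam i + lam j = m) ∧ (∃ m : ℤ, lam i - lam j = m))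
    (hchamber : ∀ i j : Fin 8, 1 ≤ (i : ℕ) → i ≤ j → lam j ≤ lam i)
    (hchamber' : 0 ≤ lam 0 + lam 5 + lam 6 + lam 7)
    (hhighest : lam 0 - lam 7 ≤ 2) :
    ∃ (k : ℕ) (η : Fin k → (Fin 8 → ℝ)),
      (∀ m, η m ∈ rootsE7) ∧
      (∀ m m', m ≠ m' → ∑ t, η m t * η m' t = 0) ∧
      lam = ∑ m, η m ∧
      (∀ m, ∑ t, lam t * η m t = 2) := by
  rcases dominant_of_pairing_highest_le_two lam hsum hlat hchamber hchamber' hhighest with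
    rfl | rfl | rfl | rfl
  · exact ⟨0, ![], by simp⟩
  · refine ⟨1, ![![1, 0, 0, 0, 0, 0, 0, -1]], ?_, ?_, ?_, ?_⟩
    · simpa using highestRoot_mem_rootsE7
    · exact fun m m' h => absurd (Subsingleton.elim m m') h
    · ext t
      fin_cases t <;> norm_num [Fin.sum_univ_succ]
    · norm_num [Fin.sum_univ_succ]
  · refine ⟨2, ![![1, 0, 0, 0, 0, 0, 0, -1],
      ![1 / 2, 1 / 2, 1 / 2, -1 / 2, -1 / 2, -1 / 2, -1 / 2, 1 / 2]], ?_, ?_, ?_, ?_⟩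
    · intro m
      fin_cases m
      · exact highestRoot_mem_rootsE7
      · refine mem_rootsE7_of_eq_half 0 1 2 7 (by decide) fun t => ?_
        fin_cases t <;> simp
    · intro m m' h
      fin_cases m <;> fin_cases m' <;> first
        | exact absurd rfl h
        | norm_num [Fin.sum_univ_succ]
    · ext t
      fin_cases t <;> norm_num [Fin.sum_univ_succ]
    · intro m
      fin_cases m <;> norm_num [Fin.sum_univ_succ]
  · refine ⟨3, ![![1 / 2, 1 / 2, 1 / 2, 1 / 2, -1 / 2, -1 / 2, -1 / 2, -1 / 2],
      ![1 / 2, 1 / 2, -1 / 2, -1 / 2, 1 / 2, 1 / 2, -1 / 2, -1 / 2],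
      ![1 / 2, 1 / 2, -1 / 2, -1 / 2, -1 / 2, -1 / 2, 1 / 2, 1 / 2]], ?_, ?_, ?_, ?_⟩
    · intro m
      fin_cases m
      · refine mem_rootsE7_of_eq_half 0 1 2 3 (by decide) fun t => ?_
        fin_cases t <;> simp
      · refine mem_rootsE7_of_eq_half 0 1 4 5 (by decide) fun t => ?_
        fin_cases t <;> simp
      · refine mem_rootsE7_of_eq_half 0 1 6 7 (by decide) fun t => ?_
        fin_cases t <;> simp
    · intro m m' h
      fin_cases m <;> fin_cases m' <;> first
        | exact absurd rfl h
        | norm_num [Fin.sum_univ_succ]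
    · ext t
      fin_cases t <;> norm_num [Fin.sum_univ_succ]
    · intro m
      fin_cases m <;> norm_num [Fin.sum_univ_succ]
end

section
/- Let λ ∈ ℓ̃ satisfy λ_2 ≥ λ_3 ≥ … ≥ λ_9, λ_2 + λ_3 + λ_4 ≤ 0, and λ_1 − λ_9 ≤ 2. Then there exist finitely many pairwise orthogonal roots η_1, …, η_k ∈ Δ such that λ = η_1 + … + η_k and ⟨λ, η_m⟩ = 2 for every m (each root η ∈ Δ satisfies ⟨η, η⟩ = 2). In fact the only possibilities are λ = 0, λ = ε_1 − ε_9, and λ = (ε_1 − ε_9) + (ε_1 + ε_2 + ε_9). -/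
/-- The vector `εᵢ = eᵢ - (1/9)(e₁ + ⋯ + e₉)` in `ℝ⁹`. -/
noncomputable def epsE8 (i : Fin 9) : Fin 9 → ℝ := fun t => (if t = i then 1 else 0) - 1 / 9

/-- The roots of type `E₈`: `εᵢ - εⱼ` for `i ≠ j`, and `±(εᵢ + εⱼ + εₖ)` for
`i, j, k` distinct. -/
def rootsE8 : Set (Fin 9 → ℝ) :=
  {v | (∃ i j, i ≠ j ∧ v = epsE8 i - epsE8 j) ∨
       (∃ i j k : Fin 9, i ≠ j ∧ i ≠ k ∧ j ≠ k ∧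
          (v = epsE8 i + epsE8 j + epsE8 k ∨ v = -(epsE8 i + epsE8 j + epsE8 k)))}

/-- The Gram matrix of the vectors `εᵢ`. -/
theorem sum_epsE8_mul_epsE8 (i j : Fin 9) :
    ∑ t, epsE8 i t * epsE8 j t = (if i = j then 1 else 0) - 1 / 9 := by
  simp only [epsE8, sub_mul, mul_sub, Finset.sum_sub_distrib]
  simp
  norm_num [eq_comm]

/-- An integral dominant weight of level at most two is `0` or one of the two fundamental weights
of mark `2`: pair it with the highest root, expanded in the simple roots. -/
theorem eq_of_level_le_two
    (lam : Fin 9 → ℝ)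
    (hsum : ∑ i, lam i = 0)
    (h3 : ∀ i, ∃ m : ℤ, 3 * lam i = m)
    (hdiff : ∀ i j, ∃ m : ℤ, lam i - lam j = m)
    (hchamber : ∀ i j : Fin 9, 1 ≤ (i : ℕ) → i ≤ j → lam j ≤ lam i)
    (hchamber' : lam 1 + lam 2 + lam 3 ≤ 0)
    (hhighest : lam 0 - lam 8 ≤ 2) :
    lam = 0 ∨ lam = epsE8 0 - epsE8 8 ∨
      lam = (epsE8 0 - epsE8 8) + (epsE8 0 + epsE8 1 + epsE8 8) := by
  have hstep (i j : Fin 9) (hi : 1 ≤ (i : ℕ)) (hij : i ≤ j) :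
      ∃ n : ℤ, 0 ≤ n ∧ lam i - lam j = n := by
    obtain ⟨n, hn⟩ := hdiff i j
    refine ⟨n, ?_, hn⟩
    have := hchamber i j hi hij
    exact_mod_cast (by linarith : (0 : ℝ) ≤ n)
  obtain ⟨x₁, p₁, h₁⟩ := hstep 1 2 (by decide) (by decide)
  obtain ⟨x₂, p₂, h₂⟩ := hstep 2 3 (by decide) (by decide)
  obtain ⟨x₃, p₃, h₃⟩ := hstep 3 4 (by decide) (by decide)
  obtain ⟨x₄, p₄, h₄⟩ := hstep 4 5 (by decide) (by decide)
  obtain ⟨x₅, p₅, h₅⟩ := hstep 5 6 (by decide) (by decide)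
  obtain ⟨x₆, p₆, h₆⟩ := hstep 6 7 (by decide) (by decide)
  obtain ⟨x₇, p₇, h₇⟩ := hstep 7 8 (by decide) (by decide)
  obtain ⟨y, q, hy⟩ : ∃ y : ℤ, 0 ≤ y ∧ -(lam 1 + lam 2 + lam 3) = y := by
    obtain ⟨m, hm⟩ := h3 1
    have h : -(lam 1 + lam 2 + lam 3) = ((2 * x₁ + x₂ - m : ℤ) : ℝ) := by
      push_cast
      linarith
    refine ⟨_, ?_, h⟩
    exact_mod_cast (by linarith : (0 : ℝ) ≤ ((2 * x₁ + x₂ - m : ℤ) : ℝ))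
  simp only [Fin.sum_univ_succ, Fin.sum_univ_zero] at hsum
  simp only [Fin.reduceSucc, Fin.isValue] at hsum
  have hlevel : 3 * y + 2 * x₁ + 4 * x₂ + 6 * x₃ + 5 * x₄ + 4 * x₅ + 3 * x₆ + 2 * x₇ ≤ 2 := by
    have : (3 * y + 2 * x₁ + 4 * x₂ + 6 * x₃ + 5 * x₄ + 4 * x₅ + 3 * x₆ + 2 * x₇ : ℝ) ≤ 2 := by
      linarith
    exact_mod_cast this
  obtain rfl : y = 0 := by omega
  obtain rfl : x₂ = 0 := by omega
  obtain rfl : x₃ = 0 := by omega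
  obtain rfl : x₄ = 0 := by omega
  obtain rfl : x₅ = 0 := by omega
  obtain rfl : x₆ = 0 := by omega
  obtain ⟨rfl, rfl⟩ | ⟨rfl, rfl⟩ | ⟨rfl, rfl⟩ :
      (x₁ = 0 ∧ x₇ = 0) ∨ (x₁ = 0 ∧ x₇ = 1) ∨ (x₁ = 1 ∧ x₇ = 0) := by omega
  all_goals push_cast at h₁ h₂ h₃ h₄ h₅ h₆ h₇ hy
  · left
    funext t
    fin_cases t <;> simp <;> linarith
  · right; left
    funext t
    fin_cases t <;> simp [epsE8] <;> linarith
  · right; right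
    funext t
    fin_cases t <;> simp [epsE8] <;> linarith

/-- **Claim (a) for type `E₈`.**  If `λ` lies in the integral lattice
`ℓ̃ = {λ ∈ 𝔱 : 3λᵢ ∈ ℤ, λᵢ - λⱼ ∈ ℤ}` and in the positive Weyl chamber
(`λ₂ ≥ ⋯ ≥ λ₉` and `λ₂ + λ₃ + λ₄ ≤ 0`), and `⟨λ, δ⟩ = λ₁ - λ₉ ≤ 2`, then `λ` is a sum of
pairwise orthogonal roots `ηₘ` with `⟨λ, ηₘ⟩ = 2` for every `m`; in fact the only
possibilities are `λ = 0`, `λ = ε₁ - ε₉` and `λ = (ε₁ - ε₉) + (ε₁ + ε₂ + ε₉)`. -/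
theorem typeE8_orthogonal_decomposition
    (lam : Fin 9 → ℝ)
    (hsum : ∑ i, lam i = 0)
    (h3 : ∀ i, ∃ m : ℤ, 3 * lam i = m)
    (hdiff : ∀ i j, ∃ m : ℤ, lam i - lam j = m)
    (hchamber : ∀ i j : Fin 9, 1 ≤ (i : ℕ) → i ≤ j → lam j ≤ lam i)
    (hchamber' : lam 1 + lam 2 + lam 3 ≤ 0)
    (hhighest : lam 0 - lam 8 ≤ 2) :
    (∃ (k : ℕ) (η : Fin k → (Fin 9 → ℝ)),
      (∀ m, η m ∈ rootsE8) ∧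
      (∀ m m', m ≠ m' → ∑ t, η m t * η m' t = 0) ∧
      lam = ∑ m, η m ∧
      (∀ m, ∑ t, lam t * η m t = 2)) ∧
    (lam = 0 ∨ lam = epsE8 0 - epsE8 8 ∨
      lam = (epsE8 0 - epsE8 8) + (epsE8 0 + epsE8 1 + epsE8 8)) := by
  have h := eq_of_level_le_two lam hsum h3 hdiff hchamber hchamber' hhighest
  refine ⟨?_, h⟩
  have hδ : epsE8 0 - epsE8 8 ∈ rootsE8 := Or.inl ⟨0, 8, by decide, rfl⟩
  have hη : epsE8 0 + epsE8 1 + epsE8 8 ∈ rootsE8 :=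
    Or.inr ⟨0, 1, 8, by decide, by decide, by decide, Or.inl rfl⟩
  rcases h with rfl | rfl | rfl
  · exact ⟨0, Fin.elim0, fun m => m.elim0, fun m => m.elim0, by simp, fun m => m.elim0⟩
  · refine ⟨1, fun _ => epsE8 0 - epsE8 8, fun _ => hδ,
      fun m m' hm => absurd (Subsingleton.elim m m') hm, by simp, fun _ => ?_⟩
    simp [sub_mul, mul_sub, Finset.sum_sub_distrib, sum_epsE8_mul_epsE8]
    norm_num
  · refine ⟨2, ![epsE8 0 - epsE8 8, epsE8 0 + epsE8 1 + epsE8 8], ?_, ?_, ?_, ?_⟩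
    · simp [Fin.forall_fin_two, hδ, hη]
    · simp [Fin.forall_fin_two, add_mul, sub_mul, mul_add, mul_sub,
        Finset.sum_add_distrib, Finset.sum_sub_distrib, sum_epsE8_mul_epsE8]
      norm_num
    · simp [Fin.sum_univ_two]
    · simp [Fin.forall_fin_two, add_mul, mul_add, mul_sub,
        Finset.sum_add_distrib, Finset.sum_sub_distrib, sum_epsE8_mul_epsE8]
      norm_num
end

section
/- Fix n ≥ 2 and let δ = e_1 − e_{n+1} be the highest root of type A_n. Let L ⊆ Δ be a subset such that (i) every root η ∈ Δ for which δ + η ∈ Δ or δ − η ∈ Δ belongs to L, and (ii) whenever η, η′ ∈ L and η + η′ ∈ Δ, also η + η′ ∈ L. Then L = Δ. -/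
theorem stdA_sub_mem_rootsA {n : ℕ} {i j : Fin (n + 1)} (h : i ≠ j) :
    stdA n i - stdA n j ∈ rootsA n :=
  ⟨i, j, h, rfl⟩

/-- **Claim (b) for type `Aₙ` (`n ≥ 2`).**  Let `δ = e₁ - e_{n+1}` be the highest root.
If `L ⊆ Δ` contains every root `η` such that `δ + η` or `δ - η` is a root, and is closed
under addition (whenever `η, η' ∈ L` and `η + η' ∈ Δ`, also `η + η' ∈ L`), then
`L = Δ`. -/
theorem typeA_generating_roots (n : ℕ) (hn : 2 ≤ n)
    (L : Set (Fin (n + 1) → ℝ)) (hLsub : L ⊆ rootsA n)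
    (hclose : ∀ η ∈ rootsA n,
      ((stdA n 0 - stdA n (Fin.last n)) + η ∈ rootsA n ∨
       (stdA n 0 - stdA n (Fin.last n)) - η ∈ rootsA n) → η ∈ L)
    (hadd : ∀ η ∈ L, ∀ η' ∈ L, η + η' ∈ rootsA n → η + η' ∈ L) :
    L = rootsA n := by
  have trans {i j : Fin (n + 1)} (k : Fin (n + 1)) (hij : i ≠ j)
      (hik : stdA n i - stdA n k ∈ L) (hkj : stdA n k - stdA n j ∈ L) :
      stdA n i - stdA n j ∈ L := by
    have h := hadd _ hik _ hkj
    rw [sub_add_sub_cancel] at h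
    exact h (stdA_sub_mem_rootsA hij)
  have zero_sub {m : Fin (n + 1)} (h0 : m ≠ 0) (hl : m ≠ Fin.last n) :
      stdA n 0 - stdA n m ∈ L :=
    hclose _ (stdA_sub_mem_rootsA h0.symm) (.inr ⟨m, Fin.last n, hl, by abel⟩)
  have sub_zero {m : Fin (n + 1)} (h0 : m ≠ 0) (hl : m ≠ Fin.last n) :
      stdA n m - stdA n 0 ∈ L :=
    hclose _ (stdA_sub_mem_rootsA h0) (.inl ⟨m, Fin.last n, hl, by abel⟩)
  have last_sub {m : Fin (n + 1)} (h0 : m ≠ 0) (hl : m ≠ Fin.last n) :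
      stdA n (Fin.last n) - stdA n m ∈ L :=
    hclose _ (stdA_sub_mem_rootsA hl.symm) (.inl ⟨0, m, h0.symm, by abel⟩)
  have sub_last {m : Fin (n + 1)} (h0 : m ≠ 0) (hl : m ≠ Fin.last n) :
      stdA n m - stdA n (Fin.last n) ∈ L :=
    hclose _ (stdA_sub_mem_rootsA hl) (.inr ⟨0, m, h0.symm, by abel⟩)
  obtain ⟨m, hm0, hml⟩ : ∃ m : Fin (n + 1), m ≠ 0 ∧ m ≠ Fin.last n :=
    ⟨⟨1, by omega⟩, by simp [Fin.ext_iff], by simp [Fin.ext_iff]; omega⟩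
  refine hLsub.antisymm ?_
  rintro _ ⟨i, j, hij, rfl⟩
  by_cases hi0 : i = 0
  · subst hi0
    by_cases hjl : j = Fin.last n
    · subst hjl
      exact trans m hij (zero_sub hm0 hml) (sub_last hm0 hml)
    · exact zero_sub hij.symm hjl
  by_cases hil : i = Fin.last n
  · subst hil
    by_cases hj0 : j = 0
    · subst hj0
      exact trans m hij (last_sub hm0 hml) (sub_zero hm0 hml)
    · exact last_sub hj0 hij.symm
  by_cases hj0 : j = 0
  · exact hj0 ▸ sub_zero hi0 hil
  by_cases hjl : j = Fin.last n
  · exact hjl ▸ sub_last hi0 hil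
  exact trans 0 hij (sub_zero hi0 hil) (zero_sub hj0 hjl)
end

section
/- Fix n ≥ 4 and let δ = e_1 + e_2 be the highest root of type D_n. Let L ⊆ Δ be a subset such that (i) every root η ∈ Δ for which δ + η ∈ Δ or δ − η ∈ Δ belongs to L, and (ii) whenever η, η′ ∈ L and η + η′ ∈ Δ, also η + η′ ∈ L. Then L = Δ. -/
/-- The `i`-th standard basis vector of `ℝⁿ`. -/
def stdD (n : ℕ) (i : Fin n) : Fin n → ℝ := fun t => if t = i then 1 else 0

/-- The roots of type `Dₙ`: `±eᵢ ± eⱼ` for `i ≠ j`. -/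
def rootsD (n : ℕ) : Set (Fin n → ℝ) :=
  {v | ∃ i j, i ≠ j ∧ (v = stdD n i + stdD n j ∨ v = stdD n i - stdD n j ∨
                       v = -stdD n i + stdD n j ∨ v = -stdD n i - stdD n j)}

/-- The roots of type `Dₙ` in signed form `s eᵢ + t eⱼ` with `s, t = ±1`. -/
theorem mem_rootsD_iff {n : ℕ} {v : Fin n → ℝ} :
    v ∈ rootsD n ↔ ∃ i j, i ≠ j ∧ ∃ s t : ℝ, (s = 1 ∨ s = -1) ∧ (t = 1 ∨ t = -1) ∧
      v = s • stdD n i + t • stdD n j := by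
  constructor
  · rintro ⟨i, j, hij, h | h | h | h⟩
    · exact ⟨i, j, hij, 1, 1, by simp, by simp, by rw [h]; module⟩
    · exact ⟨i, j, hij, 1, -1, by simp, by simp, by rw [h]; module⟩
    · exact ⟨i, j, hij, -1, 1, by simp, by simp, by rw [h]; module⟩
    · exact ⟨i, j, hij, -1, -1, by simp, by simp, by rw [h]; module⟩
  · rintro ⟨i, j, hij, s, t, rfl | rfl, rfl | rfl, rfl⟩
    · exact ⟨i, j, hij, Or.inl (by module)⟩
    · exact ⟨i, j, hij, Or.inr (Or.inl (by module))⟩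
    · exact ⟨i, j, hij, Or.inr (Or.inr (Or.inl (by module)))⟩
    · exact ⟨i, j, hij, Or.inr (Or.inr (Or.inr (by module)))⟩

/-- A signed root `s eₐ + t eₖ` with `k ∉ {a, b}` is joined to another root by a string
through `eₐ + e_b`. -/
theorem add_or_sub_mem_rootsD {n : ℕ} {a b k : Fin n} (hbk : b ≠ k) {s t : ℝ}
    (hs : s = 1 ∨ s = -1) (ht : t = 1 ∨ t = -1) :
    (stdD n a + stdD n b) + (s • stdD n a + t • stdD n k) ∈ rootsD n ∨
      (stdD n a + stdD n b) - (s • stdD n a + t • stdD n k) ∈ rootsD n := by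
  rcases hs with rfl | rfl
  · refine Or.inr (mem_rootsD_iff.2 ⟨b, k, hbk, 1, -t, by simp, ?_, by module⟩)
    rcases ht with rfl | rfl <;> simp
  · exact Or.inl (mem_rootsD_iff.2 ⟨b, k, hbk, 1, t, by simp, ht, by module⟩)

/-- **Claim (b) for type `Dₙ` (`n ≥ 4`).**  Let `δ = e₁ + e₂ ` be the highest root.
If `L ⊆ Δ` contains every root `η` such that `δ + η` or `δ - η` is a root, and is closed
under addition (whenever `η, η' ∈ L` and `η + η' ∈ Δ`, also `η + η' ∈ L`), then
`L = Δ`. -/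
theorem typeD_generating_roots (n : ℕ) (hn : 4 ≤ n)
    (L : Set (Fin n → ℝ)) (hLsub : L ⊆ rootsD n)
    (hclose : ∀ η ∈ rootsD n,
      ((stdD n ⟨0, by omega⟩ + stdD n ⟨1, by omega⟩) + η ∈ rootsD n ∨
       (stdD n ⟨0, by omega⟩ + stdD n ⟨1, by omega⟩) - η ∈ rootsD n) → η ∈ L)
    (hadd : ∀ η ∈ L, ∀ η' ∈ L, η + η' ∈ rootsD n → η + η' ∈ L) :
    L = rootsD n := by
  refine hLsub.antisymm fun v hv => ?_
  obtain ⟨i, j, hij, s, t, hs, ht, rfl⟩ := mem_rootsD_iff.1 hv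
  set p : Fin n := ⟨0, by omega⟩ with hp
  set q : Fin n := ⟨1, by omega⟩ with hq
  have mixed : ∀ a k : Fin n, (a = p ∨ a = q) → k ≠ p → k ≠ q → ∀ s t : ℝ,
      (s = 1 ∨ s = -1) → (t = 1 ∨ t = -1) → s • stdD n a + t • stdD n k ∈ L := by
    rintro a k (rfl | rfl) hkp hkq s t hs ht
    · exact hclose _ (mem_rootsD_iff.2 ⟨_, k, hkp.symm, s, t, hs, ht, rfl⟩)
        (add_or_sub_mem_rootsD hkq.symm hs ht)
    · refine hclose _ (mem_rootsD_iff.2 ⟨_, k, hkq.symm, s, t, hs, ht, rfl⟩) ?_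
      rw [add_comm (stdD n p) (stdD n q)]
      exact add_or_sub_mem_rootsD hkp.symm hs ht
  have pivot : ∀ m : Fin n, s • stdD n i + (1 : ℝ) • stdD n m ∈ L →
      t • stdD n j + (-1 : ℝ) • stdD n m ∈ L → s • stdD n i + t • stdD n j ∈ L := by
    intro m h₁ h₂
    have h : (s • stdD n i + (1 : ℝ) • stdD n m) + (t • stdD n j + (-1 : ℝ) • stdD n m) =
        s • stdD n i + t • stdD n j := by module
    rw [← h] at hv ⊢
    exact hadd _ h₁ _ h₂ hv
  by_cases hi : i = p ∨ i = q <;> by_cases hj : j = p ∨ j = q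
  · have hrp : (⟨2, by omega⟩ : Fin n) ≠ p := by simp [hp]
    have hrq : (⟨2, by omega⟩ : Fin n) ≠ q := by simp [hq]
    exact pivot _ (mixed _ _ hi hrp hrq _ _ hs (by simp)) (mixed _ _ hj hrp hrq _ _ ht (by simp))
  · rw [not_or] at hj
    exact mixed _ _ hi hj.1 hj.2 _ _ hs ht
  · rw [not_or] at hi
    rw [add_comm]
    exact mixed _ _ hj hi.1 hi.2 _ _ ht hs
  · rw [not_or] at hi hj
    refine pivot p ?_ ?_ <;> rw [add_comm]
    · exact mixed _ _ (Or.inl rfl) hi.1 hi.2 _ _ (by simp) hs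
    · exact mixed _ _ (Or.inl rfl) hj.1 hj.2 _ _ (by simp) ht
end

section
/- Let δ = e_1 + e_2 be the highest root of type F_4. Let L ⊆ Δ be a subset such that (i) every root η ∈ Δ for which δ + η ∈ Δ or δ − η ∈ Δ belongs to L, and (ii) whenever η, η′ ∈ L and η + η′ ∈ Δ, also η + η′ ∈ L. Then L = Δ. -/
/-- The `i`-th standard basis vector of `ℝ⁴`. -/
def stdF4 (i : Fin 4) : Fin 4 → ℝ := fun t => if t = i then 1 else 0

/-- The roots of type `F₄`: `±eᵢ`, `±eᵢ ± eⱼ` for `i ≠ j`, and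
`(±e₁ ± e₂ ± e₃ ± e₄)/2`. -/
def rootsF4 : Set (Fin 4 → ℝ) :=
  {v | (∃ i, v = stdF4 i ∨ v = -stdF4 i) ∨
       (∃ i j, i ≠ j ∧ (v = stdF4 i + stdF4 j ∨ v = stdF4 i - stdF4 j ∨
                        v = -stdF4 i + stdF4 j ∨ v = -stdF4 i - stdF4 j)) ∨
       (∃ s : Fin 4 → ℝ, (∀ i, s i = 1 ∨ s i = -1) ∧ v = fun i => s i / 2)}

theorem smul_stdF4_mem_rootsF4 (i : Fin 4) {x : ℝ} (hx : x = 1 ∨ x = -1) :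
    x • stdF4 i ∈ rootsF4 := by
  refine Or.inl ⟨i, ?_⟩
  rcases hx with rfl | rfl <;> simp

theorem smul_add_smul_stdF4_mem_rootsF4 {i j : Fin 4} (hij : i ≠ j) {x y : ℝ}
    (hx : x = 1 ∨ x = -1) (hy : y = 1 ∨ y = -1) :
    x • stdF4 i + y • stdF4 j ∈ rootsF4 := by
  refine Or.inr (Or.inl ⟨i, j, hij, ?_⟩)
  rcases hx with rfl | rfl <;> rcases hy with rfl | rfl <;> simp [sub_eq_add_neg]

theorem half_signs_mem_rootsF4 {s : Fin 4 → ℝ} (hs : ∀ i, s i = 1 ∨ s i = -1) :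
    (fun i => s i / 2) ∈ rootsF4 :=
  Or.inr (Or.inr ⟨s, hs, rfl⟩)

theorem neg_sign {x : ℝ} (hx : x = 1 ∨ x = -1) : -x = 1 ∨ -x = -1 := by
  rcases hx with rfl | rfl <;> simp

/-- Any set of roots which is closed under addition and contains the signed basis vectors and the
half-sign vectors whose first two signs agree contains every root. -/
theorem rootsF4_subset_of_add_closed {L : Set (Fin 4 → ℝ)}
    (hadd : ∀ η ∈ L, ∀ η' ∈ L, η + η' ∈ rootsF4 → η + η' ∈ L)
    (hbasis : ∀ (i : Fin 4) (x : ℝ), (x = 1 ∨ x = -1) → x • stdF4 i ∈ L)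
    (hhalf : ∀ s : Fin 4 → ℝ, (∀ i, s i = 1 ∨ s i = -1) → s 0 = s 1 →
      (fun i => s i / 2) ∈ L) :
    rootsF4 ⊆ L := by
  have hpair : ∀ (i j : Fin 4) (x y : ℝ), i ≠ j → (x = 1 ∨ x = -1) → (y = 1 ∨ y = -1) →
      x • stdF4 i + y • stdF4 j ∈ L := fun i j x y hij hx hy =>
    hadd _ (hbasis i x hx) _ (hbasis j y hy) (smul_add_smul_stdF4_mem_rootsF4 hij hx hy)
  rintro v (⟨i, rfl | rfl⟩ | ⟨i, j, hij, rfl | rfl | rfl | rfl⟩ | ⟨s, hs, rfl⟩)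
  · simpa using hbasis i 1 (by simp)
  · simpa using hbasis i (-1) (by simp)
  · simpa using hpair i j 1 1 hij (by simp) (by simp)
  · simpa [sub_eq_add_neg] using hpair i j 1 (-1) hij (by simp) (by simp)
  · simpa using hpair i j (-1) 1 hij (by simp) (by simp)
  · simpa [sub_eq_add_neg] using hpair i j (-1) (-1) hij (by simp) (by simp)
  · by_cases h : s 0 = s 1
    · exact hhalf s hs h
    · have h01 : s 0 = -s 1 := by
        rcases hs 0 with h0 | h0 <;> rcases hs 1 with h1 | h1 <;> simp_all
      have key : (fun i => s i / 2) =
          (fun i => ![s 0, s 0, s 2, s 3] i / 2) + s 1 • stdF4 1 := by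
        funext t
        fin_cases t <;> simp [stdF4]
        linarith
      have hroot := half_signs_mem_rootsF4 hs
      rw [key] at hroot ⊢
      refine hadd _ (hhalf _ ?_ (by simp)) _ (hbasis 1 _ (hs 1)) hroot
      intro t
      fin_cases t
      exacts [hs 0, hs 0, hs 2, hs 3]

/-- **Claim (b) for type `F₄`.**  Let `δ = e₁ + e₂` be the highest root.
If `L ⊆ Δ` contains every root `η` such that `δ + η` or `δ - η` is a root, and is closed
under addition (whenever `η, η' ∈ L` and `η + η' ∈ Δ`, also `η + η' ∈ L`), then
`L = Δ`. -/
theorem typeF4_generating_roots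
    (L : Set (Fin 4 → ℝ)) (hLsub : L ⊆ rootsF4)
    (hclose : ∀ η ∈ rootsF4,
      ((stdF4 0 + stdF4 1) + η ∈ rootsF4 ∨ (stdF4 0 + stdF4 1) - η ∈ rootsF4) → η ∈ L)
    (hadd : ∀ η ∈ L, ∀ η' ∈ L, η + η' ∈ rootsF4 → η + η' ∈ L) :
    L = rootsF4 := by
  have hsign : ∀ η ∈ rootsF4, ∀ x : ℝ, (x = 1 ∨ x = -1) →
      (stdF4 0 + stdF4 1) - x • η ∈ rootsF4 → η ∈ L := by
    rintro η hη x (rfl | rfl) h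
    · exact hclose η hη (Or.inr (by simpa using h))
    · exact hclose η hη (Or.inl (by simpa using h))
  have sq : ∀ {x : ℝ}, (x = 1 ∨ x = -1) → x * x = 1 := by
    rintro x (rfl | rfl) <;> norm_num
  have hb0 : ∀ x : ℝ, (x = 1 ∨ x = -1) → x • stdF4 0 ∈ L := fun x hx => by
    refine hsign _ (smul_stdF4_mem_rootsF4 0 hx) x hx ?_
    rw [smul_smul, sq hx]
    simpa using smul_stdF4_mem_rootsF4 1 (x := 1) (by simp)
  have hb1 : ∀ x : ℝ, (x = 1 ∨ x = -1) → x • stdF4 1 ∈ L := fun x hx => by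
    refine hsign _ (smul_stdF4_mem_rootsF4 1 hx) x hx ?_
    rw [smul_smul, sq hx]
    simpa using smul_stdF4_mem_rootsF4 0 (x := 1) (by simp)
  refine Set.Subset.antisymm hLsub (rootsF4_subset_of_add_closed hadd ?_ ?_)
  · intro k x hx
    by_cases hk0 : k = 0
    · exact hk0 ▸ hb0 x hx
    by_cases hk1 : k = 1
    · exact hk1 ▸ hb1 x hx
    have hpair : (1 : ℝ) • stdF4 0 + x • stdF4 k ∈ L := by
      refine hsign _ (smul_add_smul_stdF4_mem_rootsF4 (Ne.symm hk0) (by simp) hx) 1 (by simp) ?_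
      convert smul_add_smul_stdF4_mem_rootsF4 (x := 1) (Ne.symm hk1) (by simp) (neg_sign hx)
        using 1
      module
    have key : x • stdF4 k = ((1 : ℝ) • stdF4 0 + x • stdF4 k) + (-1 : ℝ) • stdF4 0 := by
      module
    have hroot := smul_stdF4_mem_rootsF4 k hx
    rw [key] at hroot ⊢
    exact hadd _ hpair _ (hb0 (-1) (by simp)) hroot
  · intro s hs h01
    refine hsign _ (half_signs_mem_rootsF4 hs) (s 0) (hs 0) ?_
    have hprod : ∀ i, s 0 * s i = 1 ∨ s 0 * s i = -1 := fun i => by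
      rcases hs 0 with h | h <;> rcases hs i with h' | h' <;> simp [h, h']
    have hroot := half_signs_mem_rootsF4
      (s := ![1, 1, -(s 0 * s 2), -(s 0 * s 3)]) (by
        intro t
        fin_cases t
        exacts [Or.inl rfl, Or.inl rfl, neg_sign (hprod 2), neg_sign (hprod 3)])
    convert hroot using 1
    have h0 := sq (hs 0)
    funext t
    fin_cases t <;> simp [stdF4, ← h01] <;> linarith
end

section
/- Let λ ∈ ℤ^{n+1} satisfy λ_1 + … + λ_{n+1} = 0, λ_1 ≥ λ_2 ≥ … ≥ λ_{n+1}, and λ_1 − λ_{n+1} > 2. Let α ∈ ℝ^{n+1} be nonzero with α_1 + … + α_{n+1} = 0 and α_i − α_j ∈ ℤ for all i, j. Then there exists a permutation σ of {1, …, n+1} such that |Σ_{i=1}^{n+1} α_{σ(i)} λ_i| > 1. -/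
/-- Any two distinct points can be moved to any two distinct points by a permutation. -/
theorem Equiv.Perm.exists_apply_eq_and_apply_eq {ι : Type*} [DecidableEq ι] {a b p q : ι}
    (hab : a ≠ b) (hpq : p ≠ q) : ∃ σ : Equiv.Perm ι, σ a = p ∧ σ b = q := by
  refine ⟨Equiv.swap (Equiv.swap a p b) q * Equiv.swap a p, ?_, ?_⟩
  · have h : p ≠ Equiv.swap a p b := fun h ↦
      hab ((Equiv.swap a p).injective ((Equiv.swap_apply_left a p).trans h))
    rw [Equiv.Perm.mul_apply, Equiv.swap_apply_left, Equiv.swap_apply_of_ne_of_ne h hpq]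
  · rw [Equiv.Perm.mul_apply, Equiv.swap_apply_left]

/-- Swapping two arguments changes the pairing of `f` and `g` by the product of the differences. -/
theorem sum_mul_sub_sum_swap_mul {ι R : Type*} [Fintype ι] [DecidableEq ι] [CommRing R]
    (f g : ι → R) {a b : ι} (hab : a ≠ b) :
    ∑ i, f i * g i - ∑ i, f (Equiv.swap a b i) * g i = (f a - f b) * (g a - g b) := by
  rw [← Finset.sum_sub_distrib, Fintype.sum_eq_add a b hab]
  · rw [Equiv.swap_apply_left, Equiv.swap_apply_right]
    ring
  · rintro i ⟨ha, hb⟩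
    rw [Equiv.swap_apply_of_ne_of_ne ha hb, sub_self]

/-- A nonzero real vector with coordinate sum zero is not constant. -/
theorem exists_lt_of_sum_eq_zero_of_ne_zero {ι : Type*} [Fintype ι] {f : ι → ℝ} (hf : f ≠ 0)
    (hsum : ∑ i, f i = 0) : ∃ p q, f q < f p := by
  obtain ⟨i, hi⟩ := Function.ne_iff.mp hf
  by_contra! h
  refine hi ?_
  have hconst : ∀ j, f j = f i := fun j ↦ le_antisymm (h j i) (h i j)
  have : Nonempty ι := ⟨i⟩
  simpa [hconst] using hsum

/-- **Claim (c) for type `Aₙ` (`n ≥ 2`).**  Let `λ ∈ ℤ^{n+1}` satisfy `Σ λᵢ = 0`,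
`λ₁ ≥ ⋯ ≥ λ_{n+1}` and `λ₁ - λ_{n+1} > 2`.  If `α` is a nonzero weight (`Σ αᵢ = 0` and
`αᵢ - αⱼ ∈ ℤ` for all `i, j`), then some permutation `σ` of the coordinates satisfies
`|⟨σ·α, λ⟩| > 1`. -/
theorem typeA_weight_estimate (n : ℕ) (hn : 2 ≤ n)
    (lam : Fin (n + 1) → ℝ)
    (hint : ∀ i, ∃ m : ℤ, lam i = m)
    (hsum : ∑ i, lam i = 0)
    (hmono : ∀ i j : Fin (n + 1), i ≤ j → lam j ≤ lam i)
    (hhighest : 2 < lam 0 - lam (Fin.last n))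
    (α : Fin (n + 1) → ℝ) (hα : α ≠ 0)
    (hαsum : ∑ i, α i = 0)
    (hαlat : ∀ i j, ∃ m : ℤ, α i - α j = m) :
    ∃ σ : Equiv.Perm (Fin (n + 1)), 1 < |∑ i, α (σ i) * lam i| := by
  obtain ⟨p, q, hlt⟩ := exists_lt_of_sum_eq_zero_of_ne_zero hα hαsum
  obtain ⟨m, hm⟩ := hαlat p q
  have hone : 1 ≤ α p - α q := by
    have hpos : (0 : ℝ) < m := hm ▸ sub_pos.mpr hlt
    rw [hm]
    exact_mod_cast (Int.cast_pos.mp hpos : 0 < m)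
  have hends : (0 : Fin (n + 1)) ≠ Fin.last n := by
    intro h
    rw [← h] at hhighest
    linarith
  have hpq : p ≠ q := fun h ↦ hlt.ne (by rw [h])
  obtain ⟨σ, rfl, rfl⟩ := Equiv.Perm.exists_apply_eq_and_apply_eq hends hpq
  by_contra! h
  have hdiff := sum_mul_sub_sum_swap_mul (fun i ↦ α (σ i)) lam hends
  have h₁ := (abs_le.mp (h σ)).2
  have h₂ := (abs_le.mp (h (σ * Equiv.swap 0 (Fin.last n)))).1
  simp only [Equiv.Perm.mul_apply] at h₂
  nlinarith
end

section
/- Fix n ≥ 4. Let λ ∈ ℤ^n satisfy λ_1 + … + λ_n ∈ 2ℤ, λ_1 ≥ λ_2 ≥ … ≥ λ_{n−1} ≥ |λ_n|, and λ_1 + λ_2 > 2. Let α ∈ ℝ^n be nonzero with either all α_i ∈ ℤ or all α_i ∈ ℤ + 1/2, and with α_1 ≥ α_2 ≥ … ≥ α_{n−1} ≥ |α_n|. Then ⟨α, λ⟩ = Σ_i α_i λ_i > 1. -/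
/-- A vector in the positive Weyl chamber of type `Dₙ` has nonnegative entries, except possibly
the last one. -/
theorem typeD_chamber_nonneg {n : ℕ} (hn : 2 ≤ n) {x : Fin n → ℝ}
    (hmono : ∀ i j : Fin n, i ≤ j → (j : ℕ) < n - 1 → x j ≤ x i)
    (hlast : |x ⟨n - 1, by omega⟩| ≤ x ⟨n - 2, by omega⟩)
    {i : Fin n} (hi : (i : ℕ) < n - 1) : 0 ≤ x i :=
  ((abs_nonneg _).trans hlast).trans
    (hmono i ⟨n - 2, by omega⟩ (Fin.le_def.mpr (by simp only; omega)) (by simp only; omega))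

/-- The first coordinate of a nonzero vector in the positive Weyl chamber of type `Dₙ` is
positive. -/
theorem typeD_chamber_zero_pos {n : ℕ} (hn : 2 ≤ n) {x : Fin n → ℝ}
    (hmono : ∀ i j : Fin n, i ≤ j → (j : ℕ) < n - 1 → x j ≤ x i)
    (hlast : |x ⟨n - 1, by omega⟩| ≤ x ⟨n - 2, by omega⟩)
    (hx : x ≠ 0) : 0 < x ⟨0, by omega⟩ := by
  by_contra! h
  have hzero : ∀ j : Fin n, (j : ℕ) < n - 1 → x j = 0 := fun j hj =>
    le_antisymm ((hmono ⟨0, by omega⟩ j (Fin.le_def.mpr (Nat.zero_le _)) hj).trans h)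
      (typeD_chamber_nonneg hn hmono hlast hj)
  apply hx
  funext j
  by_cases hj : (j : ℕ) < n - 1
  · exact hzero j hj
  · have hj' : j = ⟨n - 1, by omega⟩ := Fin.ext (by simp only; omega)
    rw [hzero ⟨n - 2, by omega⟩ (by simp only; omega)] at hlast
    rw [hj']
    exact abs_nonpos_iff.mp hlast

/-- On the positive Weyl chamber of type `Dₙ`, the first two terms bound the inner product from
below. -/
theorem typeD_chamber_inner_ge {n : ℕ} (hn : 3 < n) {x y : Fin n → ℝ}
    (hxmono : ∀ i j : Fin n, i ≤ j → (j : ℕ) < n - 1 → x j ≤ x i)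
    (hxlast : |x ⟨n - 1, by omega⟩| ≤ x ⟨n - 2, by omega⟩)
    (hymono : ∀ i j : Fin n, i ≤ j → (j : ℕ) < n - 1 → y j ≤ y i)
    (hylast : |y ⟨n - 1, by omega⟩| ≤ y ⟨n - 2, by omega⟩) :
    x ⟨0, by omega⟩ * y ⟨0, by omega⟩ + x ⟨1, by omega⟩ * y ⟨1, by omega⟩ ≤ ∑ i, x i * y i := by
  have hnonneg : ∀ i : Fin n, (i : ℕ) < n - 1 → 0 ≤ x i * y i := fun i hi =>
    mul_nonneg (typeD_chamber_nonneg (by omega) hxmono hxlast hi)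
      (typeD_chamber_nonneg (by omega) hymono hylast hi)
  have htail : 0 ≤ x ⟨n - 2, by omega⟩ * y ⟨n - 2, by omega⟩
      + x ⟨n - 1, by omega⟩ * y ⟨n - 1, by omega⟩ := by
    have h := mul_le_mul hxlast hylast (abs_nonneg _) ((abs_nonneg _).trans hxlast)
    rw [← abs_mul] at h
    linarith [neg_abs_le (x ⟨n - 1, by omega⟩ * y ⟨n - 1, by omega⟩)]
  obtain ⟨m, rfl⟩ := Nat.exists_eq_add_of_le' (Nat.succ_le_of_lt hn)
  rw [Fin.sum_univ_succ, Fin.sum_univ_succ, Fin.sum_univ_castSucc, Fin.sum_univ_castSucc]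
  have hmid : 0 ≤ ∑ i : Fin m, x i.castSucc.castSucc.succ.succ * y i.castSucc.castSucc.succ.succ :=
    Finset.sum_nonneg fun i _ => hnonneg _ (by simp only [Fin.val_succ, Fin.val_castSucc]; omega)
  have h2 : (Fin.last m).castSucc.succ.succ = (⟨m + 4 - 2, by omega⟩ : Fin (m + 4)) := rfl
  have h1 : (Fin.last (m + 1)).succ.succ = (⟨m + 4 - 1, by omega⟩ : Fin (m + 4)) := rfl
  have h0 : (0 : Fin (m + 4)) = ⟨0, by omega⟩ := rfl
  have h0' : (0 : Fin (m + 3)).succ = (⟨1, by omega⟩ : Fin (m + 4)) := rfl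
  rw [h2, h1, h0, h0']
  linarith


/-- **Claim (c) for type `Dₙ` (`n ≥ 4`).**  Let `λ ∈ ℤⁿ` satisfy `Σ λᵢ ∈ 2ℤ`,
`λ₁ ≥ ⋯ ≥ λ_{n-1} ≥ |λₙ|` and `λ₁ + λ₂ > 2`.  If `α` is a nonzero weight (all `αᵢ ∈ ℤ`
or all `αᵢ ∈ ℤ + 1/2`) lying in the same positive Weyl chamber
(`α₁ ≥ ⋯ ≥ α_{n-1} ≥ |αₙ|`), then `⟨α, λ⟩ = Σ αᵢ λᵢ > 1`. -/
theorem typeD_weight_estimate (n : ℕ) (hn : 4 ≤ n)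
    (lam : Fin n → ℝ)
    (hint : ∀ i, ∃ m : ℤ, lam i = m)
    (heven : ∃ k : ℤ, ∑ i, lam i = 2 * k)
    (hmono : ∀ i j : Fin n, i ≤ j → (j : ℕ) < n - 1 → lam j ≤ lam i)
    (hlast : |lam ⟨n - 1, by omega⟩| ≤ lam ⟨n - 2, by omega⟩)
    (hhighest : 2 < lam ⟨0, by omega⟩ + lam ⟨1, by omega⟩)
    (α : Fin n → ℝ) (hα : α ≠ 0)
    (hαlat : (∀ i, ∃ m : ℤ, α i = m) ∨ (∀ i, ∃ m : ℤ, α i = m + 1 / 2))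
    (hαmono : ∀ i j : Fin n, i ≤ j → (j : ℕ) < n - 1 → α j ≤ α i)
    (hαlast : |α ⟨n - 1, by omega⟩| ≤ α ⟨n - 2, by omega⟩) :
    1 < ∑ i, α i * lam i := by
  have hle := typeD_chamber_inner_ge hn hαmono hαlast hmono hlast
  have hα0 := typeD_chamber_zero_pos (by omega) hαmono hαlast hα
  have hα1 : 0 ≤ α ⟨1, by omega⟩ :=
    typeD_chamber_nonneg (by omega) hαmono hαlast (by simp only; omega)
  have hl1 : 0 ≤ lam ⟨1, by omega⟩ :=
    typeD_chamber_nonneg (by omega) hmono hlast (by simp only; omega)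
  have hl01 : lam ⟨1, by omega⟩ ≤ lam ⟨0, by omega⟩ :=
    hmono _ _ (Fin.le_def.mpr (Nat.zero_le _)) (by simp only; omega)
  rcases hαlat with hZ | hH
  · obtain ⟨a, ha⟩ := hZ ⟨0, by omega⟩
    have hge : (1 : ℝ) ≤ α ⟨0, by omega⟩ := by
      rw [ha] at hα0 ⊢
      exact_mod_cast hα0
    nlinarith [mul_nonneg hα1 hl1]
  · have hhalf : ∀ i, 0 ≤ α i → 1 / 2 ≤ α i := by
      intro i hi
      obtain ⟨a, ha⟩ := hH i
      rw [ha] at hi ⊢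
      have : (-1 : ℝ) < a := by linarith
      have : (0 : ℝ) ≤ a := by
        have : (-1 : ℤ) < a := by exact_mod_cast this
        exact_mod_cast (by omega : 0 ≤ a)
      linarith
    nlinarith [mul_le_mul_of_nonneg_right (hhalf _ hα0.le) (hl1.trans hl01),
      mul_le_mul_of_nonneg_right (hhalf _ hα1) hl1]
end
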